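/- arXiv:1903.01051 — 2 statements merged into one kernel-verified Lean document; each statement's English description precedes it below -/
import Mathlib

section
/- Define the tent function Λ_{a,b} : ℝ → ℝ by Λ_{a,b}(t) = max(0, min(t−a, b−t)) for reals a < b. Let F₁ = Λ_{0,2} + Λ_{6.5,7.5} + Λ_{8.5,9.5} + Λ_{10.5,11.5}, F₂ = Λ_{2,4} + Λ_{6.5,7.5} + Λ_{8.5,9.5} + Λ_{10.5,11.5}, F₃ = Λ_{4,6} + Λ_{6.5,7.5} + Λ_{8.5,9.5} + Λ_{10.5,11.5}, G₁ = Λ_{0.5,1.5} + Λ_{2.5,3.5} + Λ_{4.5,5.5} + Λ_{6,8}, G₂ = Λ_{0.5,1.5} + Λ_{2.5,3.5} + Λ_{4.5,5.5} + Λ_{8,10}, G₃ = Λ_{0.5,1.5} + Λ_{2.5,3.5} + Λ_{4.5,5.5} + Λ_{10,12} (pointwise sums). Then for i ≠ j: sup_{t∈ℝ} |F_i(t) − F_j(t)| = 1 and sup_{t∈ℝ} |G_i(t) − G_j(t)| = 1, while sup_{t∈ℝ} |F_i(t) − G_j(t)| = 1/2 for all i, j. Consequently, with weights α = (1, 1,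 1, −1, −1, −1) (which sum to 0) assigned to (F₁, F₂, F₃, G₁, G₂, G₃), the sum Σ_{i,j} α_i α_j d_∞(·,·) of weighted pairwise sup-distances equals 3 > 0. -/
/-- The tent (triangle) function `Λ_{a,b}(t) = max(0, min(t − a, b − t))`. -/
def tent (a b : ℝ) : ℝ → ℝ := fun t => max 0 (min (t - a) (b - t))

/-- The sup-distance between two real functions. -/
noncomputable def dSup (f g : ℝ → ℝ) : ℝ := ⨆ t : ℝ, |f t - g t|

lemma tent_nonneg (a b t : ℝ) : 0 ≤ tent a b t := le_max_left _ _

lemma tent_le_half_length {a b : ℝ} (h : a ≤ b) (t : ℝ) : tent a b t ≤ (b - a) / 2 := by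
  refine max_le (by linarith) ?_
  rcases le_total (t - a) (b - t) with h' | h'
  · rw [min_eq_left h']; linarith
  · rw [min_eq_right h']; linarith

lemma tent_eq_zero_of_le {a t : ℝ} (b : ℝ) (h : t ≤ a) : tent a b t = 0 :=
  max_eq_left ((min_le_left _ _).trans (by linarith))

lemma tent_eq_zero_of_ge {b t : ℝ} (a : ℝ) (h : b ≤ t) : tent a b t = 0 :=
  max_eq_left ((min_le_right _ _).trans (by linarith))

/-- Shrinking both ends of a tent by `c` lowers it by at most `c`. -/
lemma tent_le_add_tent_shrink (a b t : ℝ) {c : ℝ} (hc : 0 ≤ c) :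
    tent a b t ≤ c + tent (a + c) (b - c) t := by
  refine max_le (add_nonneg hc (tent_nonneg _ _ _)) ?_
  have h : min (t - (a + c)) (b - c - t) ≤ tent (a + c) (b - c) t := le_max_right _ _
  have h' : min (t - (a + c)) (b - c - t) = min (t - a) (b - t) - c := by
    rw [← min_sub_sub_right]; congr 1 <;> ring
  linarith

lemma dSup_eq_of_le_of_eq {f g : ℝ → ℝ} {c : ℝ} (hle : ∀ t, |f t - g t| ≤ c) (t : ℝ)
    (ht : |f t - g t| = c) : dSup f g = c :=
  le_antisymm (ciSup_le hle)
    (ht ▸ le_ciSup (f := fun s => |f s - g s|) ⟨c, Set.forall_mem_range.2 hle⟩ t)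

lemma dSup_self (f : ℝ → ℝ) : dSup f f = 0 := by simp [dSup]

lemma dSup_comm (f g : ℝ → ℝ) : dSup f g = dSup g f := by simp only [dSup, abs_sub_comm]

/-- The tent of height one over the `i`-th subinterval of length two of `[c, c + 6]`. -/
noncomputable def peak (c : ℝ) (i : Fin 3) (t : ℝ) : ℝ := tent (c + 2 * i) (c + 2 * i + 2) t

/-- Three tents of height one half, each centred in a subinterval of length two of `[c, c + 6]`. -/
noncomputable def comb (c t : ℝ) : ℝ :=
  tent (c + 1 / 2) (c + 3 / 2) t + tent (c + 5 / 2) (c + 7 / 2) t +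
    tent (c + 9 / 2) (c + 11 / 2) t

lemma peak_nonneg (c : ℝ) (i : Fin 3) (t : ℝ) : 0 ≤ peak c i t := tent_nonneg _ _ _

lemma peak_le_one (c : ℝ) (i : Fin 3) (t : ℝ) : peak c i t ≤ 1 :=
  (tent_le_half_length (by linarith) t).trans (by linarith)

lemma abs_peak_sub_peak_le (c : ℝ) (i j : Fin 3) (t : ℝ) : |peak c i t - peak c j t| ≤ 1 := by
  rw [abs_le]
  constructor <;> linarith [peak_nonneg c i t, peak_nonneg c j t, peak_le_one c i t,
    peak_le_one c j t]

lemma peak_eq_zero_of_le {c t : ℝ} (i : Fin 3) (h : t ≤ c) : peak c i t = 0 :=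
  tent_eq_zero_of_le _ (h.trans (le_add_of_nonneg_right (by positivity)))

lemma peak_eq_zero_of_ge {c t : ℝ} (i : Fin 3) (h : c + 6 ≤ t) : peak c i t = 0 := by
  refine tent_eq_zero_of_ge _ ?_
  have hi : ((i : ℕ) : ℝ) ≤ 2 := by exact_mod_cast Nat.lt_succ_iff.1 i.isLt
  linarith

lemma comb_eq_zero_of_le {c t : ℝ} (h : t ≤ c) : comb c t = 0 := by
  simp only [comb]
  rw [tent_eq_zero_of_le, tent_eq_zero_of_le, tent_eq_zero_of_le] <;> linarith

lemma comb_eq_zero_of_ge {c t : ℝ} (h : c + 6 ≤ t) : comb c t = 0 := by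
  simp only [comb]
  rw [tent_eq_zero_of_ge, tent_eq_zero_of_ge, tent_eq_zero_of_ge] <;> linarith

lemma comb_le_half (c t : ℝ) : comb c t ≤ 1 / 2 := by
  have h₁ := tent_le_half_length (show c + 1 / 2 ≤ c + 3 / 2 by linarith) t
  have h₂ := tent_le_half_length (show c + 5 / 2 ≤ c + 7 / 2 by linarith) t
  have h₃ := tent_le_half_length (show c + 9 / 2 ≤ c + 11 / 2 by linarith) t
  simp only [comb]
  rcases le_total t (c + 2) with h | h
  · rw [tent_eq_zero_of_le (c + 7 / 2) (by linarith), tent_eq_zero_of_le (c + 11 / 2) (by linarith)]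
    linarith
  rw [tent_eq_zero_of_ge (c + 1 / 2) (by linarith)]
  rcases le_total t (c + 4) with h' | h'
  · rw [tent_eq_zero_of_le (c + 11 / 2) (by linarith)]
    linarith
  · rw [tent_eq_zero_of_ge (c + 5 / 2) (by linarith)]
    linarith

lemma peak_le_half_add_comb (c : ℝ) (i : Fin 3) (t : ℝ) : peak c i t ≤ 1 / 2 + comb c t := by
  refine (tent_le_add_tent_shrink _ _ t (by norm_num : (0 : ℝ) ≤ 1 / 2)).trans ?_
  have h₁ := tent_nonneg (c + 1 / 2) (c + 3 / 2) t
  have h₂ := tent_nonneg (c + 5 / 2) (c + 7 / 2) t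
  have h₃ := tent_nonneg (c + 9 / 2) (c + 11 / 2) t
  simp only [comb]
  fin_cases i <;> norm_num <;> ring_nf at * <;> linarith

lemma abs_peak_sub_comb_le (c : ℝ) (i : Fin 3) (t : ℝ) : |peak c i t - comb c t| ≤ 1 / 2 := by
  rw [abs_le]
  constructor <;> linarith [peak_nonneg c i t, comb_le_half c t, peak_le_half_add_comb c i t]

lemma abs_peak_sub_peak_center (c : ℝ) {i j : Fin 3} (h : i ≠ j) :
    |peak c i (c + 2 * i + 1) - peak c j (c + 2 * i + 1)| = 1 := by
  fin_cases i <;> fin_cases j <;> first | exact absurd rfl h | norm_num [peak, tent, add_assoc]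

lemma peak_sub_comb_center (c : ℝ) (i : Fin 3) :
    peak c i (c + 2 * i + 1) - comb c (c + 2 * i + 1) = 1 / 2 := by
  fin_cases i <;> norm_num [peak, comb, tent, add_assoc]

lemma dSup_peak_add_peak_add (c : ℝ) {i j : Fin 3} (h : i ≠ j) (f : ℝ → ℝ) :
    dSup (fun t => peak c i t + f t) (fun t => peak c j t + f t) = 1 := by
  refine dSup_eq_of_le_of_eq (fun t => ?_) (c + 2 * i + 1) ?_
  · simpa only [add_sub_add_right_eq_sub] using abs_peak_sub_peak_le c i j t
  · simpa only [add_sub_add_right_eq_sub] using abs_peak_sub_peak_center c h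

lemma dSup_peak_add_comb (c : ℝ) (i j : Fin 3) :
    dSup (fun t => peak c i t + comb (c + 6) t) (fun t => peak (c + 6) j t + comb c t) = 1 / 2 := by
  have left {t : ℝ} (ht : t ≤ c + 6) : peak c i t + comb (c + 6) t -
      (peak (c + 6) j t + comb c t) = peak c i t - comb c t := by
    rw [comb_eq_zero_of_le ht, peak_eq_zero_of_le j ht]; ring
  have right {t : ℝ} (ht : c + 6 ≤ t) : peak c i t + comb (c + 6) t -
      (peak (c + 6) j t + comb c t) = -(peak (c + 6) j t - comb (c + 6) t) := by
    rw [comb_eq_zero_of_ge ht, peak_eq_zero_of_ge i ht]; ring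
  refine dSup_eq_of_le_of_eq (fun t => ?_) (c + 2 * i + 1) ?_
  · rcases le_total t (c + 6) with ht | ht
    · rw [left ht]; exact abs_peak_sub_comb_le c i t
    · rw [right ht, abs_neg]; exact abs_peak_sub_comb_le (c + 6) j t
  · have hi : ((i : ℕ) : ℝ) ≤ 2 := by exact_mod_cast Nat.lt_succ_iff.1 i.isLt
    rw [left (by linarith), peak_sub_comb_center]
    norm_num

theorem landscapes_Linfty_not_negative_type_witness :
    let F : Fin 3 → ℝ → ℝ :=
      ![fun t => tent 0 2 t + tent 6.5 7.5 t + tent 8.5 9.5 t + tent 10.5 11.5 t,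
        fun t => tent 2 4 t + tent 6.5 7.5 t + tent 8.5 9.5 t + tent 10.5 11.5 t,
        fun t => tent 4 6 t + tent 6.5 7.5 t + tent 8.5 9.5 t + tent 10.5 11.5 t]
    let G : Fin 3 → ℝ → ℝ :=
      ![fun t => tent 0.5 1.5 t + tent 2.5 3.5 t + tent 4.5 5.5 t + tent 6 8 t,
        fun t => tent 0.5 1.5 t + tent 2.5 3.5 t + tent 4.5 5.5 t + tent 8 10 t,
        fun t => tent 0.5 1.5 t + tent 2.5 3.5 t + tent 4.5 5.5 t + tent 10 12 t]
    let fs : Fin 6 → ℝ → ℝ := ![F 0, F 1, F 2, G 0, G 1, G 2]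
    let α : Fin 6 → ℝ := ![1, 1, 1, -1, -1, -1]
    (∀ i j : Fin 3, i ≠ j → dSup (F i) (F j) = 1) ∧
    (∀ i j : Fin 3, i ≠ j → dSup (G i) (G j) = 1) ∧
    (∀ i j : Fin 3, dSup (F i) (G j) = 1 / 2) ∧
    (∑ i : Fin 6, α i = 0) ∧
    (∑ i : Fin 6, ∑ j : Fin 6, α i * α j * dSup (fs i) (fs j)) = 3 ∧ (3 : ℝ) > 0 := by
  intro F G fs α
  have hF (i : Fin 3) : F i = fun t => peak 0 i t + comb (0 + 6) t := by
    funext t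
    fin_cases i <;> norm_num [F, peak, comb, add_assoc]
  have hG (i : Fin 3) : G i = fun t => peak (0 + 6) i t + comb 0 t := by
    funext t
    fin_cases i <;> norm_num [G, peak, comb] <;> ring
  have hFF (i j : Fin 3) (h : i ≠ j) : dSup (F i) (F j) = 1 := by
    rw [hF, hF]; exact dSup_peak_add_peak_add 0 h _
  have hGG (i j : Fin 3) (h : i ≠ j) : dSup (G i) (G j) = 1 := by
    rw [hG, hG]; exact dSup_peak_add_peak_add _ h _
  have hFG (i j : Fin 3) : dSup (F i) (G j) = 1 / 2 := by
    rw [hF, hG]; exact dSup_peak_add_comb 0 i j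
  have hGF (i j : Fin 3) : dSup (G i) (F j) = 1 / 2 := by rw [dSup_comm, hFG]
  refine ⟨hFF, hGG, hFG, by simp [α, Fin.sum_univ_six], ?_, by norm_num⟩
  clear_value F G
  simp only [fs, α, Fin.sum_univ_six, Matrix.cons_val, dSup_self, hFG, hGF,
    hFF 0 1 (by decide), hFF 0 2 (by decide), hFF 1 0 (by decide), hFF 1 2 (by decide),
    hFF 2 0 (by decide), hFF 2 1 (by decide), hGG 0 1 (by decide), hGG 0 2 (by decide),
    hGG 1 0 (by decide), hGG 1 2 (by decide), hGG 2 0 (by decide), hGG 2 1 (by decide)]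
  norm_num
end

section
/- Let (X, d_X) and (Y, d_Y) be separable metric spaces, each of negative type in the measure sense: for all Borel probability measures ρ₁, ρ₂ on the space with finite first moment, 2∫∫ d dρ₁ dρ₂ − ∫∫ d dρ₁ dρ₁ − ∫∫ d dρ₂ dρ₂ ≥ 0. Let θ be a Borel probability measure on X × Y whose marginals μ and ν have finite first moment, and with d_X, d_Y suitably integrable. Then the distance covariance dcov(θ) = ∫∫ d_μ(x, x') d_ν(y, y') dθ((x,y)) dθ((x',y')) is nonnegative. -/
open MeasureTheory

/-- A metric space is of negative type in the measure sense if the energy distance between any two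
Borel probability measures with finite first moment is nonnegative. -/
def IsOfNegativeType (X : Type*) [MetricSpace X] [MeasurableSpace X] : Prop :=
  ∀ ρ₁ ρ₂ : Measure X, IsProbabilityMeasure ρ₁ → IsProbabilityMeasure ρ₂ →
    (∀ x : X, Integrable (fun y => dist x y) ρ₁) →
    (∀ x : X, Integrable (fun y => dist x y) ρ₂) →
    0 ≤ 2 * (∫ x, ∫ y, dist x y ∂ρ₂ ∂ρ₁)
        - (∫ x, ∫ y, dist x y ∂ρ₁ ∂ρ₁) - (∫ x, ∫ y, dist x y ∂ρ₂ ∂ρ₂)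

theorem lipschitzWith_integral_dist {X : Type*} [MetricSpace X] [MeasurableSpace X]
    {ρ : Measure X} [IsProbabilityMeasure ρ] (hρ : ∀ x : X, Integrable (fun y => dist x y) ρ) :
    LipschitzWith 1 (fun x => ∫ y, dist x y ∂ρ) := by
  refine LipschitzWith.of_le_add fun x x' => ?_
  calc ∫ y, dist x y ∂ρ ≤ ∫ y, (dist x' y + dist x x') ∂ρ :=
        integral_mono (hρ x) ((hρ x').add (integrable_const _)) fun y => by
          linarith [dist_triangle x x' y]
    _ = ∫ y, dist x' y ∂ρ + dist x x' := by
        rw [integral_add (hρ x') (integrable_const _)]; simp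

theorem integrable_integral_dist {X : Type*} [MetricSpace X]
    [MeasurableSpace X] [BorelSpace X]
    {ρ ρ' : Measure X} [IsProbabilityMeasure ρ] [IsProbabilityMeasure ρ']
    (hρ : ∀ x : X, Integrable (fun y => dist x y) ρ)
    (hρ' : ∀ x : X, Integrable (fun y => dist x y) ρ') :
    Integrable (fun x => ∫ y, dist x y ∂ρ) ρ' := by
  have hL := lipschitzWith_integral_dist hρ
  obtain ⟨x₀⟩ : Nonempty X := nonempty_of_isProbabilityMeasure ρ
  refine ((hρ' x₀).add (integrable_const (∫ y, dist x₀ y ∂ρ))).mono'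
    hL.continuous.measurable.aestronglyMeasurable (ae_of_all _ fun x => ?_)
  rw [Real.norm_of_nonneg (integral_nonneg fun _ => dist_nonneg)]
  have := hL.dist_le_mul x x₀
  rw [Real.dist_eq, dist_comm x x₀] at this
  simp only [NNReal.coe_one, one_mul] at this
  simp only [Pi.add_apply]
  linarith [le_abs_self (∫ y, dist x y ∂ρ - ∫ y, dist x₀ y ∂ρ)]

/-- The mixture of the measures `ρ i` with weights `w i`. -/
noncomputable def mixture {ι X : Type*} [Fintype ι] [MeasurableSpace X] (w : ι → ℝ)
    (ρ : ι → Measure X) : Measure X :=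
  ∑ i, ENNReal.ofReal (w i) • ρ i

theorem integrable_mixture {ι X : Type*} [Fintype ι] [MeasurableSpace X] (w : ι → ℝ)
    {ρ : ι → Measure X} {f : X → ℝ} (hf : ∀ i, Integrable f (ρ i)) :
    Integrable f (mixture w ρ) :=
  integrable_finsetSum_measure.2 fun i _ => (hf i).smul_measure ENNReal.ofReal_ne_top

theorem integral_mixture {ι X : Type*} [Fintype ι] [MeasurableSpace X] {w : ι → ℝ}
    (hw : ∀ i, 0 ≤ w i) {ρ : ι → Measure X} {f : X → ℝ} (hf : ∀ i, Integrable f (ρ i)) :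
    ∫ x, f x ∂(mixture w ρ) = ∑ i, w i * ∫ x, f x ∂(ρ i) := by
  rw [mixture, integral_finsetSum_measure
    fun i _ => (hf i).smul_measure ENNReal.ofReal_ne_top]
  simp [integral_smul_measure, ENNReal.toReal_ofReal (hw _)]

theorem isProbabilityMeasure_mixture {ι X : Type*} [Fintype ι] [MeasurableSpace X] {w : ι → ℝ}
    (hw : ∀ i, 0 ≤ w i) (hw1 : ∑ i, w i = 1) {ρ : ι → Measure X}
    [∀ i, IsProbabilityMeasure (ρ i)] : IsProbabilityMeasure (mixture w ρ) := by
  constructor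
  simp [mixture, ← ENNReal.ofReal_sum_of_nonneg fun i _ => hw i, hw1]

theorem integral_integral_dist_mixture {ι X : Type*} [Fintype ι] [MetricSpace X]
    [MeasurableSpace X] [BorelSpace X] {w v : ι → ℝ} (hw : ∀ i, 0 ≤ w i) (hv : ∀ i, 0 ≤ v i)
    {ρ : ι → Measure X} [∀ i, IsProbabilityMeasure (ρ i)]
    (hρ : ∀ i x, Integrable (fun y => dist x y) (ρ i)) :
    ∫ x, ∫ y, dist x y ∂(mixture v ρ) ∂(mixture w ρ)
      = ∑ i, ∑ j, w i * v j * ∫ x, ∫ y, dist x y ∂(ρ j) ∂(ρ i) := by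
  have hint : ∀ i j, Integrable (fun x => ∫ y, dist x y ∂(ρ j)) (ρ i) :=
    fun i j => integrable_integral_dist (hρ j) (hρ i)
  simp_rw [integral_mixture hv fun i => hρ i _]
  rw [integral_mixture hw fun i => integrable_finsetSum _ fun j _ => (hint i j).const_mul _]
  refine Finset.sum_congr rfl fun i _ => ?_
  rw [integral_finsetSum _ fun j _ => (hint i j).const_mul _, Finset.mul_sum]
  simp_rw [integral_const_mul, mul_assoc]

theorem IsOfNegativeType.sum_mul_integral_dist_nonpos {ι X : Type*} [Fintype ι] [MetricSpace X]
    [MeasurableSpace X] [BorelSpace X] (hX : IsOfNegativeType X) {c : ι → ℝ} (hc : ∑ i, c i = 0)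
    {ρ : ι → Measure X} [∀ i, IsProbabilityMeasure (ρ i)]
    (hρ : ∀ i x, Integrable (fun y => dist x y) (ρ i))
    (hsymm : ∀ i j, ∫ x, ∫ y, dist x y ∂(ρ j) ∂(ρ i) = ∫ x, ∫ y, dist x y ∂(ρ i) ∂(ρ j)) :
    ∑ i, ∑ j, c i * c j * ∫ x, ∫ y, dist x y ∂(ρ j) ∂(ρ i) ≤ 0 := by
  set m := ∑ i, (c i)⁺ with hm
  have hm' : ∑ i, (c i)⁻ = m := by
    have : ∑ i, ((c i)⁺ - (c i)⁻) = 0 := by simpa only [posPart_sub_negPart] using hc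
    rw [Finset.sum_sub_distrib] at this
    linarith
  have hm0 : 0 ≤ m := Finset.sum_nonneg fun i _ => posPart_nonneg _
  rcases hm0.eq_or_lt with h0 | hpos
  · have hp : ∀ i, (c i)⁺ = 0 := fun i =>
      (Finset.sum_eq_zero_iff_of_nonneg fun i _ => posPart_nonneg _).1 h0.symm i
        (Finset.mem_univ i)
    have hn : ∀ i, (c i)⁻ = 0 := fun i =>
      (Finset.sum_eq_zero_iff_of_nonneg fun i _ => negPart_nonneg _).1 (hm'.trans h0.symm) i
        (Finset.mem_univ i)
    have hc0 : ∀ i, c i = 0 := fun i => by rw [← posPart_sub_negPart (c i), hp, hn, sub_zero]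
    simp [hc0]
  · have hw : ∀ i, 0 ≤ (c i)⁺ / m := fun i => div_nonneg (posPart_nonneg _) hm0
    have hv : ∀ i, 0 ≤ (c i)⁻ / m := fun i => div_nonneg (negPart_nonneg _) hm0
    have hw1 : ∑ i, (c i)⁺ / m = 1 := by rw [← Finset.sum_div, ← hm, div_self hpos.ne']
    have hv1 : ∑ i, (c i)⁻ / m = 1 := by rw [← Finset.sum_div, hm', div_self hpos.ne']
    have key := hX (mixture (fun i => (c i)⁺ / m) ρ) (mixture (fun i => (c i)⁻ / m) ρ)
      (isProbabilityMeasure_mixture hw hw1) (isProbabilityMeasure_mixture hv hv1)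
      (fun x => integrable_mixture _ fun i => hρ i x)
      (fun x => integrable_mixture _ fun i => hρ i x)
    rw [integral_integral_dist_mixture hw hv hρ, integral_integral_dist_mixture hw hw hρ,
      integral_integral_dist_mixture hv hv hρ] at key
    set E : ι → ι → ℝ := fun i j => ∫ x, ∫ y, dist x y ∂(ρ j) ∂(ρ i) with hE
    have hswap : ∑ i, ∑ j, (c i)⁺ / m * ((c j)⁻ / m) * E i j
        = ∑ i, ∑ j, (c i)⁻ / m * ((c j)⁺ / m) * E i j := by
      rw [Finset.sum_comm]
      refine Finset.sum_congr rfl fun i _ => Finset.sum_congr rfl fun j _ => ?_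
      rw [show E j i = E i j from hsymm j i]
      ring
    have hexp : ∑ i, ∑ j, c i * c j * E i j = m ^ 2 *
        (∑ i, ∑ j, (c i)⁺ / m * ((c j)⁺ / m) * E i j
          - ∑ i, ∑ j, (c i)⁺ / m * ((c j)⁻ / m) * E i j
          - ∑ i, ∑ j, (c i)⁻ / m * ((c j)⁺ / m) * E i j
          + ∑ i, ∑ j, (c i)⁻ / m * ((c j)⁻ / m) * E i j) := by
      simp only [← Finset.sum_sub_distrib, ← Finset.sum_add_distrib, Finset.mul_sum]
      refine Finset.sum_congr rfl fun i _ => Finset.sum_congr rfl fun j _ => ?_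
      have hsplit : c i * c j = ((c i)⁺ - (c i)⁻) * ((c j)⁺ - (c j)⁻) := by
        simp only [posPart_sub_negPart]
      rw [hsplit]
      field_simp
      ring
    rw [hexp]
    exact mul_nonpos_of_nonneg_of_nonpos (sq_nonneg m) (by linarith)

/-- The negative of the doubly centred distance function. -/
noncomputable def centredKernel {X : Type*} [MetricSpace X] [MeasurableSpace X] (μ : Measure X) :
    Matrix X X ℝ :=
  fun x x' => ∫ y, dist x y ∂μ + ∫ y, dist x' y ∂μ - dist x x' - ∫ z, ∫ y, dist z y ∂μ ∂μ

theorem continuous_centredKernel {X : Type*} [MetricSpace X] [MeasurableSpace X]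
    {μ : Measure X} [IsProbabilityMeasure μ] (hμ : ∀ x : X, Integrable (fun y => dist x y) μ) :
    Continuous (fun q : X × X => centredKernel μ q.1 q.2) := by
  have hL := (lipschitzWith_integral_dist hμ).continuous
  exact (((hL.comp continuous_fst).add (hL.comp continuous_snd)).sub continuous_dist).sub
    continuous_const

theorem IsOfNegativeType.posSemidef_centredKernel {X : Type*} [MetricSpace X]
    [MeasurableSpace X] [BorelSpace X] (hX : IsOfNegativeType X)
    {μ : Measure X} [IsProbabilityMeasure μ] (hμ : ∀ x : X, Integrable (fun y => dist x y) μ) :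
    (centredKernel μ).PosSemidef := by
  refine ⟨?_, fun c => ?_⟩
  · ext x x'
    simp only [Matrix.conjTranspose_apply, star_trivial, centredKernel, dist_comm x' x]
    ring
  · set C := ∑ i : c.support, c i with hC
    let ρ : Option c.support → Measure X := fun o => o.elim μ fun i => Measure.dirac i
    have hprob : ∀ o, IsProbabilityMeasure (ρ o) := by
      rintro (_ | i)
      · assumption
      · exact Measure.dirac.isProbabilityMeasure
    have hint : ∀ o x, Integrable (fun y => dist x y) (ρ o) := by
      rintro (_ | i) x
      · exact hμ x
      · exact integrable_dirac (by simp)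
    have hL := (lipschitzWith_integral_dist hμ).continuous.stronglyMeasurable
    have key := hX.sum_mul_integral_dist_nonpos (c := fun o => o.elim (-C) fun i => c i)
      (by simp [Fintype.sum_option, hC]) hint (by
        rintro (_ | i) (_ | j) <;> simp [ρ, dist_comm, integral_dirac' _ _ hL])
    simp only [Fintype.sum_option, Option.elim] at key
    simp only [ρ, Option.elim, integral_dirac' _ _ hL] at key
    simp only [Finsupp.sum, ← Finset.sum_attach c.support, ← Finset.univ_eq_attach]
    have hexp : ∑ i : c.support, ∑ j : c.support,
        star (c i) * centredKernel μ (i : X) (j : X) * c j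
        = C * ∑ i : c.support, c i * ∫ y, dist (i : X) y ∂μ
          + C * ∑ i : c.support, c i * ∫ y, dist (i : X) y ∂μ
          - ∑ i : c.support, ∑ j : c.support, c i * c j * dist (i : X) j
          - C * C * ∫ z, ∫ y, dist z y ∂μ ∂μ := by
      have h1 : C * ∑ i : c.support, c i * ∫ y, dist (i : X) y ∂μ
          = ∑ i : c.support, ∑ j : c.support, c i * (c j * ∫ y, dist (j : X) y ∂μ) := by
        rw [hC, Finset.sum_mul_sum]
      have h2 : C * ∑ i : c.support, c i * ∫ y, dist (i : X) y ∂μ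
          = ∑ i : c.support, ∑ j : c.support, (c i * ∫ y, dist (i : X) y ∂μ) * c j := by
        rw [mul_comm, hC, Finset.sum_mul_sum]
      nth_rewrite 1 [h1]
      rw [h2, hC, Finset.sum_mul_sum, Finset.sum_mul]
      simp only [Finset.sum_mul, ← Finset.sum_sub_distrib, ← Finset.sum_add_distrib,
        centredKernel, star_trivial]
      refine Finset.sum_congr rfl fun i _ => Finset.sum_congr rfl fun j _ => ?_
      ring
    have h1 : ∑ i : c.support, -C * c i * ∫ y, dist y (i : X) ∂μ
        = -(C * ∑ i : c.support, c i * ∫ y, dist (i : X) y ∂μ) := by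
      simp only [Finset.mul_sum, ← Finset.sum_neg_distrib, dist_comm]
      refine Finset.sum_congr rfl fun i _ => ?_
      ring
    have h2 : ∑ i : c.support, c i * -C * ∫ y, dist (i : X) y ∂μ
        = -(C * ∑ i : c.support, c i * ∫ y, dist (i : X) y ∂μ) := by
      simp only [Finset.mul_sum, ← Finset.sum_neg_distrib]
      refine Finset.sum_congr rfl fun i _ => ?_
      ring
    have hdirac : ∀ x x' : X, ∫ y, dist x y ∂(Measure.dirac x') = dist x x' := fun x x' =>
      integral_dirac' _ _ (continuous_const.dist continuous_id).stronglyMeasurable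
    simp only [hdirac, Finset.sum_add_distrib] at key
    have hdist : ∀ x : X, StronglyMeasurable (fun y => dist y x) := fun x =>
      (continuous_id.dist continuous_const).stronglyMeasurable
    simp only [integral_dirac' _ _ (hdist _)] at key
    rw [hexp]
    linarith

theorem integral_integral_nonneg_of_integrable_diag {Z : Type*} [MeasurableSpace Z]
    {θ : Measure Z} [IsProbabilityMeasure θ] {M : Matrix Z Z ℝ} (hM : M.PosSemidef)
    (hint : Integrable (fun w : Z × Z => M w.1 w.2) (θ.prod θ))
    (hdiag : Integrable (fun z => M z z) θ) :
    0 ≤ ∫ w, M w.1 w.2 ∂(θ.prod θ) := by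
  set I := ∫ w, M w.1 w.2 ∂(θ.prod θ) with hI
  set J := ∫ z, M z z ∂θ with hJ
  have hpair : ∀ (n : ℕ) (i j : Fin n), i ≠ j → MeasurePreserving
      (fun ω : Fin n → Z => (ω i, ω j)) (Measure.pi fun _ => θ) (θ.prod θ) := by
    intro n i j hij
    refine ⟨by fun_prop, ?_⟩
    have hind := (ProbabilityTheory.iIndepFun_pi (μ := fun _ : Fin n => θ) (X := fun _ => id)
      (fun _ => aemeasurable_id)).indepFun hij
    have := hind.map_prod_eq_prod_map_map (measurable_pi_apply i).aemeasurable
      (measurable_pi_apply j).aemeasurable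
    exact this.trans (congrArg₂ Measure.prod (measurePreserving_eval _ i).map_eq
      (measurePreserving_eval _ j).map_eq)
  have hterm : ∀ (n : ℕ) (i j : Fin n),
      Integrable (fun ω : Fin n → Z => M (ω i) (ω j)) (Measure.pi fun _ => θ) ∧
      ∫ ω : Fin n → Z, M (ω i) (ω j) ∂(Measure.pi fun _ => θ) = if i = j then J else I := by
    intro n i j
    split_ifs with hij
    · subst hij
      have hp := measurePreserving_eval (fun _ : Fin n => θ) i
      refine ⟨hp.integrable_comp_of_integrable hdiag, ?_⟩
      have := integral_map hp.measurable.aemeasurable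
        (hp.map_eq.symm ▸ hdiag.aestronglyMeasurable)
      rw [hp.map_eq] at this
      exact this.symm
    · have hp := hpair n i j hij
      refine ⟨hp.integrable_comp_of_integrable hint, ?_⟩
      rw [hI, ← hp.map_eq, integral_map hp.measurable.aemeasurable
        (hp.map_eq.symm ▸ hint.aestronglyMeasurable)]
  have hbound : ∀ k : ℕ, 0 ≤ J + k * I := by
    intro k
    have h0 : 0 ≤ ∫ ω : Fin (k + 1) → Z, ∑ i, ∑ j, M (ω i) (ω j) ∂(Measure.pi fun _ => θ) := by
      refine integral_nonneg fun ω => ?_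
      simpa [dotProduct, Matrix.mulVec] using
        (hM.submatrix ω).dotProduct_mulVec_nonneg (fun _ => 1)
    rw [integral_finsetSum _ fun i _ => integrable_finsetSum _ fun j _ => (hterm _ i j).1] at h0
    simp_rw [integral_finsetSum _ fun j _ => (hterm _ _ j).1, (hterm _ _ _).2] at h0
    have hrow : ∀ i : Fin (k + 1), ∑ j, (if i = j then J else I) = J + k * I := by
      intro i
      have : ∀ j, (if i = j then J else I) = I + if i = j then J - I else 0 := by
        intro j; split_ifs <;> ring
      simp only [this, Finset.sum_add_distrib, Finset.sum_ite_eq, Finset.mem_univ, if_true]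
      simp
      ring
    simp only [hrow, Finset.sum_const, Finset.card_univ, Fintype.card_fin, nsmul_eq_mul] at h0
    exact nonneg_of_mul_nonneg_right h0 (by positivity)
  by_contra! hneg
  obtain ⟨k, hk⟩ := exists_nat_gt (J / -I)
  rw [div_lt_iff₀ (by linarith)] at hk
  linarith [hbound k]

theorem integral_nonneg_of_posSemidef {Z : Type*} [MeasurableSpace Z]
    {θ : Measure Z} [IsProbabilityMeasure θ] {M : Matrix Z Z ℝ} (hM : M.PosSemidef)
    (hint : Integrable (fun w : Z × Z => M w.1 w.2) (θ.prod θ))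
    (hdiag : Measurable (fun z => M z z)) :
    0 ≤ ∫ w, M w.1 w.2 ∂(θ.prod θ) := by
  let S : ℕ → Set Z := fun n => {z | M z z ≤ n}
  have hS : ∀ n, MeasurableSet (S n) := fun n => measurableSet_le hdiag measurable_const
  let g : ℕ → Z → ℝ := fun n => (S n).indicator 1
  have hg : ∀ n, Measurable (g n) := fun n => measurable_one.indicator (hS n)
  have hg1 : ∀ n z, ‖g n z‖ ≤ 1 := fun n z => by
    by_cases h : z ∈ S n <;> simp [g, h]
  have hbd : ∀ n, ∀ w : Z × Z, ‖g n w.1 * M w.1 w.2 * g n w.2‖ ≤ ‖M w.1 w.2‖ := fun n w => by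
    rw [norm_mul, norm_mul]
    calc ‖g n w.1‖ * ‖M w.1 w.2‖ * ‖g n w.2‖ ≤ 1 * ‖M w.1 w.2‖ * 1 := by
          gcongr <;> exact hg1 _ _
      _ = ‖M w.1 w.2‖ := by ring
  have hmeas : ∀ n, AEStronglyMeasurable (fun w : Z × Z => g n w.1 * M w.1 w.2 * g n w.2)
      (θ.prod θ) := fun n =>
    (((hg n).comp measurable_fst).aestronglyMeasurable.mul hint.aestronglyMeasurable).mul
      ((hg n).comp measurable_snd).aestronglyMeasurable
  have hlim : Filter.Tendsto (fun n => ∫ w, g n w.1 * M w.1 w.2 * g n w.2 ∂(θ.prod θ))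
      Filter.atTop (nhds (∫ w, M w.1 w.2 ∂(θ.prod θ))) := by
    refine tendsto_integral_of_dominated_convergence (fun w => ‖M w.1 w.2‖) hmeas hint.norm
      (fun n => ae_of_all _ (hbd n)) (ae_of_all _ fun w => ?_)
    refine tendsto_const_nhds.congr' ?_
    obtain ⟨k, hk⟩ := exists_nat_ge (max (M w.1 w.1) (M w.2 w.2))
    filter_upwards [Filter.eventually_ge_atTop k] with n hn
    have hkn : (k : ℝ) ≤ n := by exact_mod_cast hn
    have h1 : w.1 ∈ S n := ((le_max_left _ _).trans hk).trans hkn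
    have h2 : w.2 ∈ S n := ((le_max_right _ _).trans hk).trans hkn
    simp [g, h1, h2]
  refine ge_of_tendsto' hlim fun n => ?_
  have hrank : (Matrix.vecMulVec (g n) (g n)).PosSemidef := by
    refine ⟨by ext; simp [Matrix.vecMulVec_apply, mul_comm], fun x => ?_⟩
    convert mul_self_nonneg (x.sum fun i xi => xi * g n i) using 1
    simp only [Finsupp.sum, Finset.sum_mul_sum, star_trivial, Matrix.vecMulVec_apply]
    refine Finset.sum_congr rfl fun i _ => Finset.sum_congr rfl fun j _ => ?_
    ring
  have hN : (Matrix.of fun z z' => g n z * M z z' * g n z').PosSemidef := by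
    have heq : (Matrix.of fun z z' => g n z * M z z' * g n z')
        = (Matrix.vecMulVec (g n) (g n)).hadamard M := by
      ext z z'
      simp only [Matrix.of_apply, Matrix.hadamard_apply, Matrix.vecMulVec_apply]
      ring
    exact heq ▸ hrank.hadamard hM
  refine integral_integral_nonneg_of_integrable_diag hN (hint.mono (hmeas n) (ae_of_all _ (hbd n)))
    ((integrable_const (n : ℝ)).mono' (((hg n).mul hdiag).mul (hg n)).aestronglyMeasurable
      (ae_of_all _ fun z => ?_))
  have hz : 0 ≤ M z z := hM.diag_nonneg
  by_cases h : z ∈ S n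
  · have hle : M z z ≤ n := h
    simpa [g, h, abs_of_nonneg hz] using hle
  · simp [g, h]

theorem dcov_nonneg_of_negative_type
    {X Y : Type*} [MetricSpace X] [MetricSpace Y]
    [TopologicalSpace.SeparableSpace X] [TopologicalSpace.SeparableSpace Y]
    [MeasurableSpace X] [BorelSpace X] [MeasurableSpace Y] [BorelSpace Y]
    (hX : ∀ ρ₁ ρ₂ : Measure X, IsProbabilityMeasure ρ₁ → IsProbabilityMeasure ρ₂ →
      (∀ x : X, Integrable (fun y => dist x y) ρ₁) →
      (∀ x : X, Integrable (fun y => dist x y) ρ₂) →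
      0 ≤ 2 * (∫ x, ∫ y, dist x y ∂ρ₂ ∂ρ₁)
          - (∫ x, ∫ y, dist x y ∂ρ₁ ∂ρ₁) - (∫ x, ∫ y, dist x y ∂ρ₂ ∂ρ₂))
    (hY : ∀ ρ₁ ρ₂ : Measure Y, IsProbabilityMeasure ρ₁ → IsProbabilityMeasure ρ₂ →
      (∀ x : Y, Integrable (fun y => dist x y) ρ₁) →
      (∀ x : Y, Integrable (fun y => dist x y) ρ₂) →
      0 ≤ 2 * (∫ x, ∫ y, dist x y ∂ρ₂ ∂ρ₁)
          - (∫ x, ∫ y, dist x y ∂ρ₁ ∂ρ₁) - (∫ x, ∫ y, dist x y ∂ρ₂ ∂ρ₂))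
    (θ : Measure (X × Y)) [IsProbabilityMeasure θ]
    (μ : Measure X) (ν : Measure Y)
    (hμ : μ = θ.map Prod.fst) (hν : ν = θ.map Prod.snd)
    (hμfm : ∀ x : X, Integrable (fun y => dist x y) μ)
    (hνfm : ∀ y : Y, Integrable (fun y' => dist y y') ν)
    (hμ2 : Integrable (fun q : X × X => dist q.1 q.2) (μ.prod μ))
    (hν2 : Integrable (fun q : Y × Y => dist q.1 q.2) (ν.prod ν))
    (hθ2 : Integrable (fun w : (X × Y) × (X × Y) =>
        (dist w.1.1 w.2.1 - (∫ y, dist w.1.1 y ∂μ) - (∫ y, dist w.2.1 y ∂μ)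
            + ∫ z, ∫ y, dist z y ∂μ ∂μ)
          * (dist w.1.2 w.2.2 - (∫ y, dist w.1.2 y ∂ν) - (∫ y, dist w.2.2 y ∂ν)
            + ∫ z, ∫ y, dist z y ∂ν ∂ν)) (θ.prod θ)) :
    0 ≤ (∫ w, ∫ w',
        (dist w.1 w'.1 - (∫ y, dist w.1 y ∂μ) - (∫ y, dist w'.1 y ∂μ)
            + ∫ z, ∫ y, dist z y ∂μ ∂μ)
          * (dist w.2 w'.2 - (∫ y, dist w.2 y ∂ν) - (∫ y, dist w'.2 y ∂ν)
            + ∫ z, ∫ y, dist z y ∂ν ∂ν)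
        ∂θ ∂θ) := by
  have : IsProbabilityMeasure μ := hμ ▸ Measure.isProbabilityMeasure_map (by fun_prop)
  have : IsProbabilityMeasure ν := hν ▸ Measure.isProbabilityMeasure_map (by fun_prop)
  let M : Matrix (X × Y) (X × Y) ℝ :=
    ((centredKernel μ).submatrix Prod.fst Prod.fst).hadamard
      ((centredKernel ν).submatrix Prod.snd Prod.snd)
  have hM : M.PosSemidef :=
    ((IsOfNegativeType.posSemidef_centredKernel hX hμfm).submatrix Prod.fst).hadamard
      ((IsOfNegativeType.posSemidef_centredKernel hY hνfm).submatrix Prod.snd)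
  have hMeq : ∀ w w' : X × Y, (dist w.1 w'.1 - (∫ y, dist w.1 y ∂μ) - (∫ y, dist w'.1 y ∂μ)
            + ∫ z, ∫ y, dist z y ∂μ ∂μ)
          * (dist w.2 w'.2 - (∫ y, dist w.2 y ∂ν) - (∫ y, dist w'.2 y ∂ν)
            + ∫ z, ∫ y, dist z y ∂ν ∂ν) = M w w' := by
    intro w w'
    simp only [M, Matrix.hadamard_apply, Matrix.submatrix_apply, centredKernel]
    ring
  simp only [hMeq] at hθ2 ⊢
  rw [← integral_prod _ hθ2]
  refine integral_nonneg_of_posSemidef hM hθ2 (Continuous.measurable ?_)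
  have h1 := continuous_centredKernel hμfm
  have h2 := continuous_centredKernel hνfm
  exact (h1.comp (continuous_fst.prodMk continuous_fst)).mul
    (h2.comp (continuous_snd.prodMk continuous_snd))
end
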